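/- arXiv:1204.0276 — 2 statements merged into one kernel-verified Lean document; each statement's English description precedes it below -/
import Mathlib

section
/- Let Γ be a group in which every element g satisfies g·g = 1, acting on a set X, and let Γ act diagonally on X × X by g·(x,y) = (g·x, g·y). Then for all x, y ∈ X, the pair (y,x) lies in the Γ-orbit of (x,y) under the diagonal action if and only if y lies in the Γ-orbit of x. -/
/-- If `Γ` is a group in which every element squares to the identity,
acting on a set `X` (with the diagonal action on `X × X`), then for all `x y : X`,
the pair `(y, x)` lies in the `Γ`-orbit of `(x, y)` iff `y` lies in the `Γ`-orbit of `x`. -/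
theorem orbit_swap_mem_iff {Γ X : Type*} [Group Γ] [MulAction Γ X]
    (h2 : ∀ g : Γ, g * g = 1) (x y : X) :
    (y, x) ∈ MulAction.orbit Γ (x, y) ↔ y ∈ MulAction.orbit Γ x := by
  constructor
  · rintro ⟨g, hg⟩
    exact ⟨g, congrArg Prod.fst hg⟩
  · rintro ⟨g, rfl⟩
    exact ⟨g, Prod.ext rfl (by simp [smul_smul, h2])⟩
end

section
/- In the setting below, for every s ∈ S the R-linear endomorphism T_s of M satisfies (T_s + id) ∘ (T_s − u²·id) = 0; equivalently T_s ∘ T_s = (u²−1)·T_s + u²·id on M. -/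
open Finsupp

noncomputable section

/-- `R = ℤ[u, u⁻¹]`, the ring of Laurent polynomials over `ℤ`. -/
abbrev R : Type := LaurentPolynomial ℤ

/-- The indeterminate `u`. -/
noncomputable def u : R := LaurentPolynomial.T 1

/-- `I_* = {w ∈ W : w* = w⁻¹}`, the set of twisted involutions. -/
def Istar {W : Type*} [Group W] (star : W ≃* W) : Set W := {w : W | star w = w⁻¹}

/-- `M`, the free `R`-module with basis `(a_w)` indexed by `w ∈ I_*`
(the basis element `a_w` is `Finsupp.single w 1`). -/
abbrev InvolModule {W : Type*} [Group W] (star : W ≃* W) : Type _ := ↥(Istar star) →₀ R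

/-- The assertion that the `R`-linear map `T : M → M` is the map `T_s` (for `s` the
simple reflection of index `i`) defined by:
`T_s a_w = u a_w + (u+1) a_{sw}` if `sw = w s*` and `l(sw) > l(w)`;
`T_s a_w = (u²−u−1) a_w + (u²−u) a_{sw}` if `sw = w s*` and `l(sw) < l(w)`;
`T_s a_w = a_{s w s*}` if `sw ≠ w s*` and `l(sw) > l(w)`;
`T_s a_w = (u²−1) a_w + u² a_{s w s*}` if `sw ≠ w s*` and `l(sw) < l(w)`. -/
def IsTs {B W : Type*} [Group W] {Mat : CoxeterMatrix B} (cs : CoxeterSystem Mat W)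
    (star : W ≃* W) (i : B) (T : InvolModule star →ₗ[R] InvolModule star) : Prop :=
  ∀ w : ↥(Istar star),
    (∀ w' : ↥(Istar star), (w' : W) = cs.simple i * (w : W) →
      cs.simple i * (w : W) = (w : W) * star (cs.simple i) →
      (cs.length (cs.simple i * (w : W)) > cs.length (w : W) →
        T (single w 1) = u • single w 1 + (u + 1) • single w' 1) ∧
      (cs.length (cs.simple i * (w : W)) < cs.length (w : W) →
        T (single w 1) = (u ^ 2 - u - 1) • single w 1 + (u ^ 2 - u) • single w' 1)) ∧
    (∀ w' : ↥(Istar star), (w' : W) = cs.simple i * (w : W) * star (cs.simple i) →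
      cs.simple i * (w : W) ≠ (w : W) * star (cs.simple i) →
      (cs.length (cs.simple i * (w : W)) > cs.length (w : W) →
        T (single w 1) = single w' 1) ∧
      (cs.length (cs.simple i * (w : W)) < cs.length (w : W) →
        T (single w 1) = (u ^ 2 - 1) • single w 1 + (u ^ 2 : R) • single w' 1))

namespace CoxeterSystem

variable {B W : Type*} [Group W] {Mat : CoxeterMatrix B} (cs : CoxeterSystem Mat W)

open Classical in
/-- The permutation `(t, ε) ↦ (s t s, ε + [t = s])` of `W × ZMod 2` attached to a simple
reflection `s`. -/
def signedConj (i : B) : Equiv.Perm (W × ZMod 2) :=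
  Function.Involutive.toPerm
    (fun p => (cs.simple i * p.1 * cs.simple i, p.2 + if p.1 = cs.simple i then 1 else 0)) <| by
    rintro ⟨t, ε⟩
    have h : cs.simple i * t * cs.simple i = cs.simple i ↔ t = cs.simple i := by
      rw [mul_eq_right, mul_eq_one_iff_eq_inv', cs.inv_simple]
    simp only [h, Prod.mk.injEq]
    refine ⟨by simp [mul_assoc], ?_⟩
    rw [add_assoc, CharTwo.add_self_eq_zero, add_zero]

open Classical in
theorem signedConj_apply (i : B) (t : W) (ε : ZMod 2) :
    cs.signedConj i (t, ε) =
      (cs.simple i * t * cs.simple i, ε + if t = cs.simple i then 1 else 0) :=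
  rfl

theorem simple_mul_pow_simple_mul_simple (i j : B) (k : ℕ) :
    cs.simple j * (cs.simple i * cs.simple j) ^ k =
      ((cs.simple i * cs.simple j) ^ k)⁻¹ * cs.simple j := by
  induction k with
  | zero => simp
  | succ k ih =>
    rw [pow_succ, ← mul_assoc, ih, ← pow_succ, pow_succ']
    simp [mul_assoc]

open Classical in
theorem signedConj_mul_pow_apply (i j : B) (k : ℕ) (t : W) (ε : ZMod 2) :
    ((cs.signedConj i * cs.signedConj j) ^ k) (t, ε) =
      ((cs.simple i * cs.simple j) ^ k * t * ((cs.simple i * cs.simple j) ^ k)⁻¹,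
        ε + ∑ q ∈ Finset.range (2 * k),
          if t = cs.simple j * (cs.simple i * cs.simple j) ^ q then 1 else 0) := by
  induction k with
  | zero => simp
  | succ k ih =>
    set p := cs.simple i * cs.simple j with hp
    have hj := cs.simple_mul_pow_simple_mul_simple i j k
    rw [← hp] at hj
    have h₁ : p ^ k * t * (p ^ k)⁻¹ = cs.simple j ↔ t = cs.simple j * p ^ (2 * k) := by
      rw [two_mul, pow_add, ← mul_assoc, hj, mul_inv_eq_iff_eq_mul, ← eq_inv_mul_iff_mul_eq,
        ← mul_assoc, ← hj, mul_assoc]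
    have h₂ : cs.simple j * (p ^ k * t * (p ^ k)⁻¹) * cs.simple j = cs.simple i ↔
        t = cs.simple j * p ^ (2 * k + 1) := by
      have hji : cs.simple j * cs.simple i * cs.simple j = cs.simple j * p := by
        rw [hp, mul_assoc]
      rw [mul_assoc, ← eq_inv_mul_iff_mul_eq, cs.inv_simple, ← eq_mul_inv_iff_mul_eq,
        cs.inv_simple, hji, mul_inv_eq_iff_eq_mul, ← eq_inv_mul_iff_mul_eq, ← mul_assoc,
        ← mul_assoc, ← hj, mul_assoc, mul_assoc, ← pow_succ', ← pow_add]
      ring_nf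
    rw [pow_succ', Equiv.Perm.mul_apply, ih, Equiv.Perm.mul_apply, signedConj_apply,
      signedConj_apply, h₁, h₂, mul_add_one, Finset.sum_range_succ, Finset.sum_range_succ]
    simp [hp, pow_succ', mul_assoc, add_assoc]

theorem isLiftable_signedConj : Mat.IsLiftable cs.signedConj := by
  classical
  intro i j
  ext1 ⟨t, ε⟩
  rw [signedConj_mul_pow_apply, two_mul, Finset.sum_range_add]
  simp [pow_add, cs.simple_mul_simple_pow, CharTwo.add_self_eq_zero]

/-- The action of `W` on `W × ZMod 2` whose second component records, modulo 2, how often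
an element occurs in a right inversion sequence. -/
def signedConjHom : W →* Equiv.Perm (W × ZMod 2) :=
  cs.lift ⟨cs.signedConj, cs.isLiftable_signedConj⟩

theorem signedConjHom_simple (i : B) : cs.signedConjHom (cs.simple i) = cs.signedConj i :=
  cs.lift_apply_simple cs.isLiftable_signedConj i

open Classical in
theorem signedConjHom_wordProd_apply (ω : List B) (t : W) (ε : ZMod 2) :
    cs.signedConjHom (cs.wordProd ω) (t, ε) =
      (cs.wordProd ω * t * (cs.wordProd ω)⁻¹, ε + ((cs.rightInvSeq ω).count t : ZMod 2)) := by
  induction ω with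
  | nil => simp
  | cons i ω ih =>
    have h : cs.wordProd ω * t * (cs.wordProd ω)⁻¹ = cs.simple i ↔
        (cs.wordProd ω)⁻¹ * cs.simple i * cs.wordProd ω = t := by
      constructor
      · intro h; simp [← h, mul_assoc]
      · intro h; simp [← h, mul_assoc]
    rw [wordProd_cons, map_mul, Equiv.Perm.mul_apply, ih, signedConjHom_simple, signedConj_apply,
      rightInvSeq, List.count_cons, h]
    simp [mul_assoc, add_assoc]

theorem signedConjHom_apply_fst (w t : W) (ε : ZMod 2) :
    (cs.signedConjHom w (t, ε)).1 = w * t * w⁻¹ := by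
  obtain ⟨ω, rfl⟩ := cs.wordProd_surjective w
  rw [signedConjHom_wordProd_apply]

theorem signedConjHom_apply_snd (w t : W) (ε : ZMod 2) :
    (cs.signedConjHom w (t, ε)).2 = ε + (cs.signedConjHom w (t, 0)).2 := by
  obtain ⟨ω, rfl⟩ := cs.wordProd_surjective w
  simp [signedConjHom_wordProd_apply]

theorem length_mul_lt_of_signedConjHom_snd_ne_zero {w t : W}
    (h : (cs.signedConjHom w (t, 0)).2 ≠ 0) : cs.length (w * t) < cs.length w := by
  classical
  obtain ⟨ω, hω, rfl⟩ := cs.exists_isReduced w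
  rw [signedConjHom_wordProd_apply, zero_add] at h
  refine (cs.isRightInversion_of_mem_rightInvSeq hω (t := t) ?_).2
  by_contra hmem
  simp [List.count_eq_zero_of_not_mem hmem] at h

theorem signedConjHom_snd_eq_zero_iff (w : W) (j : B) :
    (cs.signedConjHom w (cs.simple j, 0)).2 = 0 ↔
      cs.length w < cs.length (w * cs.simple j) := by
  constructor
  · intro h
    have key : (cs.signedConjHom (w * cs.simple j) (cs.simple j, 0)).2 ≠ 0 := by
      rw [map_mul, Equiv.Perm.mul_apply, signedConjHom_simple, signedConj_apply]
      simp [signedConjHom_apply_snd (ε := 1), h]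
    simpa using cs.length_mul_lt_of_signedConjHom_snd_ne_zero key
  · intro h
    by_contra hne
    exact h.asymm (cs.length_mul_lt_of_signedConjHom_snd_ne_zero hne)

/-- A form of the exchange condition. -/
theorem simple_mul_eq_mul_simple_of_length {w : W} {i j : B}
    (hj : cs.length w < cs.length (w * cs.simple j))
    (hij : cs.length (cs.simple i * w * cs.simple j) < cs.length (cs.simple i * w)) :
    cs.simple i * w = w * cs.simple j := by
  have h₁ := (cs.signedConjHom_snd_eq_zero_iff w j).2 hj
  have h₂ := mt (cs.signedConjHom_snd_eq_zero_iff (cs.simple i * w) j).1 hij.asymm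
  have h₃ : cs.signedConjHom w (cs.simple j, 0) = (w * cs.simple j * w⁻¹, 0) :=
    Prod.ext (cs.signedConjHom_apply_fst _ _ _) h₁
  rw [map_mul, Equiv.Perm.mul_apply, h₃, signedConjHom_simple, signedConj_apply] at h₂
  have h₄ : w * cs.simple j * w⁻¹ = cs.simple i := by
    by_contra hne
    simp [hne] at h₂
  rw [← h₄, inv_mul_cancel_right]

theorem length_simple_mul_mul_simple_of_lt {w : W} {i j : B}
    (hne : cs.simple i * w ≠ w * cs.simple j)
    (heq : cs.length (w * cs.simple j) = cs.length (cs.simple i * w))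
    (hlt : cs.length w < cs.length (cs.simple i * w)) :
    cs.length (cs.simple i * w) < cs.length (cs.simple i * w * cs.simple j) := by
  by_contra hcon
  have := cs.length_mul_simple_ne (cs.simple i * w) j
  exact hne (cs.simple_mul_eq_mul_simple_of_length (by omega) (by omega))

theorem length_simple_mul_mul_simple_of_gt {w : W} {i j : B}
    (hne : cs.simple i * w ≠ w * cs.simple j)
    (heq : cs.length (w * cs.simple j) = cs.length (cs.simple i * w))
    (hgt : cs.length (cs.simple i * w) < cs.length w) :
    cs.length (cs.simple i * w * cs.simple j) < cs.length (cs.simple i * w) := by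
  by_contra hcon
  have := cs.length_mul_simple_ne (cs.simple i * w) j
  have h := cs.simple_mul_eq_mul_simple_of_length (w := cs.simple i * w) (i := i) (j := j)
    (by omega) (by simpa [heq] using hgt)
  rw [cs.simple_mul_simple_cancel_left] at h
  apply hne
  nth_rw 2 [h]
  rw [cs.simple_mul_simple_cancel_right]

theorem length_map_le {f : W →* W} (hf : ∀ i, ∃ j, f (cs.simple i) = cs.simple j) (w : W) :
    cs.length (f w) ≤ cs.length w := by
  choose g hg using hf
  obtain ⟨ω, hω, rfl⟩ := cs.exists_isReduced w
  have h : f (cs.wordProd ω) = cs.wordProd (ω.map g) := by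
    simp [wordProd, map_list_prod, Function.comp_def, hg]
  rw [h, hω.eq]
  simpa using cs.length_wordProd_le (ω.map g)

end CoxeterSystem

section TwistedInvolutions

variable {B W : Type*} [Group W] {Mat : CoxeterMatrix B} (cs : CoxeterSystem Mat W)
  {star : W ≃* W}

theorem length_mul_star_simple (hstar2 : ∀ w : W, star (star w) = w)
    (hstarS : ∀ i : B, ∃ j : B, star (cs.simple i) = cs.simple j)
    {w : W} (hw : w ∈ Istar star) (i : B) :
    cs.length (w * star (cs.simple i)) = cs.length (cs.simple i * w) := by
  have hle : ∀ x, cs.length (star x) ≤ cs.length x :=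
    cs.length_map_le (f := star.toMonoidHom) hstarS
  have h : star (cs.simple i * w) = (w * star (cs.simple i))⁻¹ := by
    rw [map_mul, show star w = w⁻¹ from hw, mul_inv_rev, ← map_inv, cs.inv_simple]
  rw [← cs.length_inv, ← h]
  refine (hle _).antisymm ?_
  simpa [hstar2] using hle (star (cs.simple i * w))

theorem simple_mul_mem_Istar {w : W} (hw : w ∈ Istar star) {i : B}
    (h : cs.simple i * w = w * star (cs.simple i)) : cs.simple i * w ∈ Istar star := by
  have hw' : star w = w⁻¹ := hw
  change star (cs.simple i * w) = (cs.simple i * w)⁻¹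
  rw [h, mul_inv_rev, ← map_inv, cs.inv_simple, ← hw', ← map_mul, h]

theorem simple_mul_mul_star_mem_Istar (hstar2 : ∀ w : W, star (star w) = w)
    {w : W} (hw : w ∈ Istar star) (i : B) :
    cs.simple i * w * star (cs.simple i) ∈ Istar star := by
  have hw' : star w = w⁻¹ := hw
  change star (cs.simple i * w * star (cs.simple i)) = _
  simp [hstar2, hw', ← map_inv, mul_assoc]

theorem IsTs.apply_apply_single (hstar2 : ∀ w : W, star (star w) = w)
    (hstarS : ∀ i : B, ∃ j : B, star (cs.simple i) = cs.simple j)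
    {i : B} {T : InvolModule star →ₗ[R] InvolModule star} (hT : IsTs cs star i T)
    (w : Istar star) :
    T (T (single w 1)) = (u ^ 2 - 1 : R) • T (single w 1) + (u ^ 2 : R) • single w 1 := by
  have hss : star (cs.simple i) * star (cs.simple i) = 1 := by
    rw [← map_mul, cs.simple_mul_simple_self, map_one]
  by_cases hc : cs.simple i * (w : W) = w * star (cs.simple i)
  · let w' : Istar star := ⟨cs.simple i * w, simple_mul_mem_Istar cs w.2 hc⟩
    have hw : (w : W) = cs.simple i * (w' : W) := by simp [w']
    have hc' : cs.simple i * (w' : W) = w' * star (cs.simple i) := by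
      rw [← hw]; simp only [w']; rw [hc, mul_assoc, hss, mul_one]
    have h := (hT w).1 w' rfl hc
    have h' := (hT w').1 w hw hc'
    rw [← hw] at h'
    rcases lt_or_gt_of_ne (cs.length_simple_mul_ne w i) with hl | hl
    · rw [h.2 hl, map_add, map_smul, map_smul, h.2 hl, h'.1 hl]
      match_scalars <;> ring
    · rw [h.1 hl, map_add, map_smul, map_smul, h.1 hl, h'.2 hl]
      match_scalars <;> ring
  · let w' : Istar star :=
      ⟨cs.simple i * w * star (cs.simple i), simple_mul_mul_star_mem_Istar cs hstar2 w.2 i⟩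
    have hs : cs.simple i * (w' : W) = w * star (cs.simple i) := by simp [w', mul_assoc]
    have hs' : (w' : W) * star (cs.simple i) = cs.simple i * w := by
      simp [w', mul_assoc, hss]
    have hw : (w : W) = cs.simple i * (w' : W) * star (cs.simple i) := by
      rw [hs, mul_assoc, hss, mul_one]
    have hc' : cs.simple i * (w' : W) ≠ w' * star (cs.simple i) := by
      rw [hs, hs']; exact Ne.symm hc
    have h := (hT w).2 w' rfl hc
    have h' := (hT w').2 w hw hc'
    have hlen := length_mul_star_simple cs hstar2 hstarS w.2 i
    rw [hs, hlen] at h'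
    obtain ⟨j, hj⟩ := hstarS i
    have hw' : (w' : W) = cs.simple i * w * cs.simple j := by rw [← hj]
    rw [hj] at hc hlen
    rw [hw'] at h'
    rcases lt_or_gt_of_ne (cs.length_simple_mul_ne w i) with hl | hl
    · rw [h.2 hl, map_add, map_smul, map_smul, h.2 hl,
        h'.1 (cs.length_simple_mul_mul_simple_of_gt hc hlen hl)]
    · rw [h.1 hl, h'.2 (cs.length_simple_mul_mul_simple_of_lt hc hlen hl)]

end TwistedInvolutions

/-- each `T_s` satisfies the quadratic relation
`(T_s + id) ∘ (T_s − u²·id) = 0`, equivalently `T_s ∘ T_s = (u²−1)·T_s + u²·id`. -/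
theorem Ts_quadratic_relation {B W : Type*} [Group W] {Mat : CoxeterMatrix B}
    (cs : CoxeterSystem Mat W) (star : W ≃* W)
    (hstar2 : ∀ w : W, star (star w) = w)
    (hstarS : ∀ i : B, ∃ j : B, star (cs.simple i) = cs.simple j)
    (i : B) (T : InvolModule star →ₗ[R] InvolModule star) (hT : IsTs cs star i T) :
    (T + LinearMap.id).comp (T - (u ^ 2 : R) • LinearMap.id) = 0 ∧
    T.comp T = (u ^ 2 - 1 : R) • T + (u ^ 2 : R) • LinearMap.id := by
  have key : T.comp T = (u ^ 2 - 1 : R) • T + (u ^ 2 : R) • LinearMap.id := by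
    refine Finsupp.lhom_ext' fun w => LinearMap.ext_ring ?_
    exact hT.apply_apply_single cs hstar2 hstarS w
  refine ⟨?_, key⟩
  rw [LinearMap.add_comp, LinearMap.comp_sub, LinearMap.comp_smul, LinearMap.comp_id,
    LinearMap.id_comp, key]
  module

end
end
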